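/- Let n ≥ 6 and 1 ≤ s ≤ n−1. (a) If G is a cograph on k ≤ n−2 vertices, then M*_G < M_{K_{s,n−s}}. (b) If G is a cograph on n−1 vertices, then M*_G < M_{K_{1,n−1}}. -/

import Mathlib

open SimpleGraph Finset

/-- The collection of nonempty vertex subsets inducing a connected subgraph. -/
noncomputable def connSets {V : Type*} [Fintype V] (G : SimpleGraph V) : Finset (Finset V) :=
  (Set.toFinite {S : Finset V | S.Nonempty ∧ (G.induce (S : Set V)).Connected}).toFinset

/-- The global mean `M_G`: the average cardinality of the nonempty vertex subsets
inducing a connected subgraph. -/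
noncomputable def globalMean {V : Type*} [Fintype V] (G : SimpleGraph V) : ℝ :=
  (∑ S ∈ connSets G, (S.card : ℝ)) / ((connSets G).card : ℝ)

/-- The collection of vertex subsets containing `v` and inducing a connected subgraph. -/
noncomputable def localSets {V : Type*} [Fintype V] (G : SimpleGraph V) (v : V) :
    Finset (Finset V) :=
  (Set.toFinite {S : Finset V | v ∈ S ∧ (G.induce (S : Set V)).Connected}).toFinset

/-- The local mean `M_{G,v}`: the average cardinality of the vertex subsets containing `v`
and inducing a connected subgraph. -/
noncomputable def localMean {V : Type*} [Fintype V] (G : SimpleGraph V) (v : V) : ℝ :=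
  (∑ S ∈ localSets G v, (S.card : ℝ)) / ((localSets G v).card : ℝ)

/-- The collection of vertex subsets of size at least `2` inducing a connected subgraph. -/
noncomputable def mstarSets {V : Type*} [Fintype V] (G : SimpleGraph V) : Finset (Finset V) :=
  (Set.toFinite {S : Finset V | 2 ≤ S.card ∧ (G.induce (S : Set V)).Connected}).toFinset

/-- The `M*` mean `M*_G`: the average cardinality of the vertex subsets of size at least `2`
inducing a connected subgraph (it equals `0` if there are no such subsets, by the
`0/0 = 0` convention of real division). -/
noncomputable def mstarMean {V : Type*} [Fintype V] (G : SimpleGraph V) : ℝ :=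
  (∑ S ∈ mstarSets G, (S.card : ℝ)) / ((mstarSets G).card : ℝ)

/-- A cograph is a graph with no induced subgraph isomorphic to the path on 4 vertices. -/
def IsCograph {V : Type*} (G : SimpleGraph V) : Prop :=
  IsEmpty (SimpleGraph.pathGraph 4 ↪g G)

/-- The `n`-skillet `S_n = K_1 + (K_1 ∪ K_{n-2})`: vertex `0` is adjacent to all other
vertices, vertex `1` is adjacent only to vertex `0`, and the vertices `2, …, n-1` form a
clique, each also adjacent to vertex `0`. -/
def skillet (n : ℕ) : SimpleGraph (Fin n) :=
  SimpleGraph.fromRel (fun i j => (i : ℕ) = 0 ∨ (2 ≤ (i : ℕ) ∧ 2 ≤ (j : ℕ)))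

open Classical in
noncomputable def FF {V : Type*} (G : SimpleGraph V) (W : Finset V) (c : ℝ) : ℝ :=
  ∑ S ∈ W.powerset.filter (fun S : Finset V => S.Nonempty ∧ (G.induce (S : Set V)).Connected),
    ((S.card : ℝ) - c)

/-- No-edge split or full-join split. -/
def Split {V : Type*} (G : SimpleGraph V) (W : Finset V) : Prop :=
  ∃ A B : Finset V, A.Nonempty ∧ B.Nonempty ∧ Disjoint A B ∧ (∀ x, x ∈ W ↔ x ∈ A ∨ x ∈ B) ∧
    ((∀ a ∈ A, ∀ b ∈ B, ¬ G.Adj a b) ∨ (∀ a ∈ A, ∀ b ∈ B, G.Adj a b))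

def NoP4 {V : Type*} (G : SimpleGraph V) : Prop :=
  ∀ a b c d, G.Adj a b → G.Adj b c → G.Adj c d → ¬ G.Adj a c → ¬ G.Adj a d → ¬ G.Adj b d →
    a ≠ c → a ≠ d → b ≠ d → False

lemma noP4_of_cograph {V : Type*} {G : SimpleGraph V} (h : IsCograph G) : NoP4 G := by
  intro a b c d hab hbc hcd hac had hbd nac nad nbd
  have nab := hab.ne
  have nbc := hbc.ne
  have ncd := hcd.ne
  refine h.false ⟨⟨![a, b, c, d], ?_⟩, ?_⟩
  · intro i j hij
    fin_cases i <;> fin_cases j <;> simp_all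
  · intro i j
    rw [SimpleGraph.pathGraph_adj]
    change G.Adj (![a, b, c, d] i) (![a, b, c, d] j) ↔ _
    have hba := hab.symm
    have hcb := hbc.symm
    have hdc := hcd.symm
    have hca : ¬ G.Adj c a := fun h => hac (G.adj_symm h)
    have hda : ¬ G.Adj d a := fun h => had (G.adj_symm h)
    have hdb : ¬ G.Adj d b := fun h => hbd (G.adj_symm h)
    fin_cases i <;> fin_cases j <;> simp [*]

lemma NoP4.compl {V : Type*} {G : SimpleGraph V} (h : NoP4 G) : NoP4 Gᶜ := by
  intro a b c d hab hbc hcd hac had hbd nac nad nbd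
  simp only [SimpleGraph.compl_adj, not_and, not_not] at *
  exact h b d a c (hbd nbd) (had nad).symm (hac nac) (fun h => hab.2 h.symm) hbc.2
    (fun h => hcd.2 h.symm) hab.1.symm hbc.1 hcd.1.symm

lemma split_compl {V : Type*} {G : SimpleGraph V} {W : Finset V} (h : Split Gᶜ W) :
    Split G W := by
  obtain ⟨A, B, hA, hB, hd, hW, h⟩ := h
  refine ⟨A, B, hA, hB, hd, hW, ?_⟩
  have hne : ∀ a ∈ A, ∀ b ∈ B, a ≠ b := by
    intro a ha b hb
    rintro rfl; exact Finset.disjoint_left.1 hd ha hb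
  rcases h with h | h
  · right
    intro a ha b hb
    have := h a ha b hb
    simp only [SimpleGraph.compl_adj, not_and, not_not] at this
    exact this (hne a ha b hb)
  · left
    intro a ha b hb
    exact (h a ha b hb).2

open Classical in
lemma split_step {V : Type*} {G : SimpleGraph V} (hG : NoP4 G) (v : V) (W A B : Finset V)
    (hv : v ∉ W) (hA : A.Nonempty) (hB : B.Nonempty) (hd : Disjoint A B)
    (hW : ∀ x, x ∈ W ↔ x ∈ A ∨ x ∈ B) (h : ∀ a ∈ A, ∀ b ∈ B, ¬ G.Adj a b) :
    Split G (insert v W) := by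
  have key : ∀ A B : Finset V, B.Nonempty → Disjoint A B → (∀ x, x ∈ W ↔ x ∈ A ∨ x ∈ B) →
      (∀ a ∈ A, ∀ b ∈ B, ¬ G.Adj a b) → (∃ x ∈ A, ∃ y ∈ A, G.Adj x y ∧ G.Adj v x ∧ ¬ G.Adj v y) →
      Split G (insert v W) := by
    rintro A B hB hd hW h ⟨x, hx, y, hy, hxy, hvx, hvy⟩
    refine ⟨insert v A, B, by simp, hB, ?_, ?_, Or.inl ?_⟩
    · rw [Finset.disjoint_insert_left]
      exact ⟨fun hb => hv ((hW v).2 (Or.inr hb)), hd⟩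
    · intro z; simp [hW, or_assoc]
    · intro a ha b hb hab
      rcases Finset.mem_insert.1 ha with rfl | ha
      · refine hG b a x y hab.symm hvx hxy (fun h' => h x hx b hb h'.symm)
          (fun h' => h y hy b hb h'.symm) hvy ?_ ?_ ?_
        · rintro rfl; exact Finset.disjoint_left.1 hd hx hb
        · rintro rfl; exact Finset.disjoint_left.1 hd hy hb
        · rintro rfl; exact hv ((hW _).2 (Or.inl hy))
      · exact h a ha b hb hab
  by_cases hE : ∃ x ∈ W, ∃ y ∈ W, G.Adj x y ∧ G.Adj v x ∧ ¬ G.Adj v y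
  · obtain ⟨x, hx, y, hy, hxy, h1, h2⟩ := hE
    rcases (hW x).1 hx with hx | hx
    · rcases (hW y).1 hy with hy | hy
      · exact key A B hB hd hW h ⟨x, hx, y, hy, hxy, h1, h2⟩
      · exact absurd hxy (h x hx y hy)
    · rcases (hW y).1 hy with hy | hy
      · exact absurd hxy.symm (h y hy x hx)
      · exact key B A hA hd.symm (fun x => by rw [hW, or_comm])
          (fun a ha b hb hab => h b hb a ha hab.symm) ⟨x, hx, y, hy, hxy, h1, h2⟩
  · push Not at hE
    by_cases hM : ∃ y ∈ W, ¬ G.Adj v y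
    · obtain ⟨y, hy, hvy⟩ := hM
      refine ⟨insert v (W.filter (fun x => G.Adj v x)), W.filter (fun x => ¬ G.Adj v x),
        by simp, ⟨y, by simp [hy, hvy]⟩, ?_, ?_, Or.inl ?_⟩
      · rw [Finset.disjoint_left]
        intro z hz hz2
        simp only [Finset.mem_insert, Finset.mem_filter] at hz hz2
        rcases hz with rfl | hz
        · exact hv hz2.1
        · exact hz2.2 hz.2
      · intro z
        simp only [Finset.mem_insert, Finset.mem_filter]
        tauto
      · intro a ha b hb hab
        simp only [Finset.mem_insert, Finset.mem_filter] at ha hb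
        rcases ha with rfl | ha
        · exact hb.2 hab
        · exact hb.2 (hE a ha.1 b hb.1 hab ha.2)
    · push Not at hM
      refine ⟨{v}, W, by simp, ?_, by simpa using hv, by simp, Or.inr (by simpa using hM)⟩
      obtain ⟨a, ha⟩ := hA
      exact ⟨a, (hW a).2 (Or.inl ha)⟩

open Classical in
lemma split_exists {V : Type*} {G : SimpleGraph V} (hG : NoP4 G) (W : Finset V) :
    2 ≤ W.card → Split G W := by
  induction W using Finset.induction_on with
  | empty => simp
  | insert v W hv ih =>
    intro hc
    rw [Finset.card_insert_of_notMem hv] at hc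
    by_cases h1 : W.card = 1
    · obtain ⟨w, rfl⟩ := Finset.card_eq_one.1 h1
      refine ⟨{v}, {w}, by simp, by simp, by simpa using hv, by simp, ?_⟩
      simp only [Finset.mem_singleton, forall_eq]
      tauto
    · obtain ⟨A, B, hA, hB, hd, hW, h⟩ := ih (by omega)
      rcases h with h | h
      · exact split_step hG v W A B hv hA hB hd hW h
      · apply split_compl
        exact split_step hG.compl v W A B hv hA hB hd hW
          (fun a ha b hb hab => hab.2 (h a ha b hb))

lemma conn_side {V : Type*} {G : SimpleGraph V} {A B S : Finset V}
    (h : ∀ a ∈ A, ∀ b ∈ B, ¬ G.Adj a b) (hS : ∀ x ∈ S, x ∈ A ∨ x ∈ B)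
    (hc : (G.induce (S : Set V)).Connected) : S ⊆ A ∨ S ⊆ B := by
  by_cases hA : ∃ x ∈ S, x ∈ A
  · left
    obtain ⟨x, hx, hxA⟩ := hA
    intro y hy
    obtain ⟨p⟩ := hc.preconnected ⟨x, hx⟩ ⟨y, hy⟩
    have : ∀ u w : (S : Set V), (G.induce (S : Set V)).Walk u w → u.1 ∈ A → w.1 ∈ A := by
      intro u w p
      induction p with
      | nil => exact id
      | @cons u v w hadj p ih =>
        intro hu
        apply ih
        rcases hS v.1 v.2 with hv | hv
        · exact hv
        · exact absurd hadj (h _ hu _ hv)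
    exact this _ _ p hxA
  · right
    push Not at hA
    intro y hy
    exact (hS y hy).resolve_left (hA y hy)

lemma conn_join {V : Type*} {G : SimpleGraph V} {A B S : Finset V}
    (h : ∀ a ∈ A, ∀ b ∈ B, G.Adj a b) (hS : ∀ x ∈ S, x ∈ A ∨ x ∈ B)
    (h1 : ¬ S ⊆ A) (h2 : ¬ S ⊆ B) : (G.induce (S : Set V)).Connected := by
  obtain ⟨b, hb, hbA⟩ := Finset.not_subset.1 h1
  obtain ⟨a, ha, haB⟩ := Finset.not_subset.1 h2
  have hbB := (hS b hb).resolve_left hbA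
  have haA := (hS a ha).resolve_right haB
  rw [SimpleGraph.connected_iff_exists_forall_reachable]
  refine ⟨⟨a, ha⟩, ?_⟩
  rintro ⟨w, hw⟩
  have r1 : (G.induce (S : Set V)).Reachable ⟨a, ha⟩ ⟨b, hb⟩ :=
    SimpleGraph.Adj.reachable (h a haA b hbB)
  rcases hS w hw with hwA | hwB
  · have r2 : (G.induce (S : Set V)).Reachable ⟨w, hw⟩ ⟨b, hb⟩ :=
      SimpleGraph.Adj.reachable (h w hwA b hbB)
    exact r1.trans r2.symm
  · exact SimpleGraph.Adj.reachable (h a haA w hwB)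

open Classical in
lemma FF_inter {V : Type*} {G : SimpleGraph V} {A B W : Finset V} (hd : Disjoint A B)
    (hW : ∀ x, x ∈ W ↔ x ∈ A ∨ x ∈ B) (f : Finset V → ℝ) (P : Finset V → Prop) :
    ∑ S ∈ W.powerset with (S.Nonempty ∧ P S), f S =
      ∑ S ∈ A.powerset with (S.Nonempty ∧ P S), f S
      + ∑ S ∈ B.powerset with (S.Nonempty ∧ P S), f S
      + ∑ S ∈ W.powerset with ((¬ S ⊆ A ∧ ¬ S ⊆ B) ∧ P S), f S := by
  have hAW : A ⊆ W := fun x hx => (hW x).2 (Or.inl hx)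
  have hBW : B ⊆ W := fun x hx => (hW x).2 (Or.inr hx)
  rw [← Finset.sum_union, ← Finset.sum_union]
  · apply Finset.sum_congr _ (fun _ _ => rfl)
    ext S
    simp only [Finset.mem_filter, Finset.mem_union, Finset.mem_powerset]
    constructor
    · tauto
    · rintro ((h | h) | h)
      · exact ⟨h.1.trans hAW, h.2⟩
      · exact ⟨h.1.trans hBW, h.2⟩
      · refine ⟨h.1, ?_, h.2.2⟩
        rw [Finset.nonempty_iff_ne_empty]
        rintro rfl
        simp at h
  · rw [Finset.disjoint_left]
    intro S
    simp only [Finset.mem_filter, Finset.mem_union, Finset.mem_powerset]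
    tauto
  · rw [Finset.disjoint_left]
    intro S
    simp only [Finset.mem_filter, Finset.mem_powerset]
    rintro ⟨h1, ⟨x, hx⟩, _⟩ ⟨h2, _⟩
    exact Finset.disjoint_left.1 hd (h1 hx) (h2 hx)

open Classical in
lemma FF_inter2 {V : Type*} {G : SimpleGraph V} {A B W : Finset V} (hd : Disjoint A B)
    (hW : ∀ x, x ∈ W ↔ x ∈ A ∨ x ∈ B) (c : ℝ) :
    FF G W c = FF G A c + FF G B c
      + ∑ S ∈ W.powerset.filter (fun S : Finset V => (¬ S ⊆ A ∧ ¬ S ⊆ B) ∧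
          (G.induce (S : Set V)).Connected), ((S.card : ℝ) - c) := by
  have := FF_inter (G := G) hd hW (fun S => (S.card : ℝ) - c)
    (fun S => (G.induce (S : Set V)).Connected)
  unfold FF
  convert this

lemma FF_disj {V : Type*} {G : SimpleGraph V} {A B W : Finset V} (hd : Disjoint A B)
    (hW : ∀ x, x ∈ W ↔ x ∈ A ∨ x ∈ B) (h : ∀ a ∈ A, ∀ b ∈ B, ¬ G.Adj a b) (c : ℝ) :
    FF G W c = FF G A c + FF G B c := by
  classical
  rw [FF_inter2 (G := G) hd hW, Finset.filter_false_of_mem, Finset.sum_empty, add_zero]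
  rintro S hS ⟨⟨h1, h2⟩, h3⟩
  rcases conn_side h (fun x hx => (hW x).1 (Finset.mem_powerset.1 hS hx)) h3 with h | h
  · exact h1 h
  · exact h2 h

lemma sum_powerset_card {V : Type*} (W : Finset V) (c : ℝ) :
    ∑ S ∈ W.powerset, ((S.card : ℝ) - c) = 2 ^ W.card * (W.card / 2 - c) := by
  classical
  induction W using Finset.induction_on with
  | empty => simp
  | insert v W hv ih =>
    rw [Finset.sum_powerset_insert hv, Finset.card_insert_of_notMem hv, ih]
    have : ∑ S ∈ W.powerset, (((insert v S).card : ℝ) - c)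
        = ∑ S ∈ W.powerset, (((S.card : ℝ) - c) + 1) := by
      apply Finset.sum_congr rfl
      intro S hS
      rw [Finset.card_insert_of_notMem (fun h => hv (Finset.mem_powerset.1 hS h))]
      push_cast; ring
    rw [this, Finset.sum_add_distrib, ih]
    simp
    ring

lemma FF_join {V : Type*} {G : SimpleGraph V} {A B W : Finset V} (hd : Disjoint A B)
    (hW : ∀ x, x ∈ W ↔ x ∈ A ∨ x ∈ B) (h : ∀ a ∈ A, ∀ b ∈ B, G.Adj a b) (c : ℝ) :
    FF G W c = FF G A c + FF G B c +
      (2 ^ (A.card + B.card) * (((A.card : ℝ) + B.card) / 2 - c) - 2 ^ A.card * (A.card / 2 - c)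
        - 2 ^ B.card * (B.card / 2 - c) - c) := by
  classical
  have e : W = A ∪ B := by ext x; simp [hW]
  have hc : W.card = A.card + B.card := by rw [e, Finset.card_union_of_disjoint hd]
  have e1 := sum_powerset_card W c
  have e2 := sum_powerset_card A c
  have e3 := sum_powerset_card B c
  rw [← Finset.sum_filter_add_sum_filter_not _ (fun S => S.Nonempty)] at e1 e2 e3
  have emp : ∀ X : Finset V, ∑ S ∈ X.powerset with ¬ S.Nonempty, ((S.card : ℝ) - c) = -c := by
    intro X
    have : X.powerset.filter (fun S => ¬ S.Nonempty) = {∅} := by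
      ext S
      simp only [Finset.mem_filter, Finset.mem_powerset, Finset.not_nonempty_iff_eq_empty,
        Finset.mem_singleton]
      constructor
      · exact fun h => h.2
      · rintro rfl; simp
    rw [this]; simp
  rw [emp] at e1 e2 e3
  have e4 := FF_inter (G := G) hd hW (fun S => (S.card : ℝ) - c) (fun _ => True)
  simp only [and_true] at e4
  rw [FF_inter2 (G := G) hd hW]
  have e5 : W.powerset.filter (fun S : Finset V => (¬ S ⊆ A ∧ ¬ S ⊆ B) ∧ (G.induce (S : Set V)).Connected)
    = W.powerset.filter (fun S : Finset V => (¬ S ⊆ A ∧ ¬ S ⊆ B)) := by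
    apply Finset.filter_congr
    intro S hS
    constructor
    · exact fun h => h.1
    · exact fun h' => ⟨h',
        conn_join h (fun x hx => (hW x).1 (Finset.mem_powerset.1 hS hx)) h'.1 h'.2⟩
  rw [e5]
  rw [hc] at e1
  push_cast at e1
  linarith

lemma FF_empty {V : Type*} (G : SimpleGraph V) (c : ℝ) : FF G ∅ c = 0 := by
  classical
  unfold FF
  apply Finset.sum_eq_zero
  intro S hS
  simp only [Finset.mem_filter, Finset.mem_powerset, Finset.subset_empty] at hS
  obtain ⟨rfl, h, _⟩ := hS
  simp at h

lemma conn_singleton {V : Type*} (G : SimpleGraph V) (v : V) :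
    (G.induce (({v} : Finset V) : Set V)).Connected := by
  rw [SimpleGraph.connected_iff_exists_forall_reachable]
  refine ⟨⟨v, by simp⟩, ?_⟩
  rintro ⟨w, hw⟩
  have : w = v := by simpa using hw
  subst this
  exact SimpleGraph.Reachable.refl _

lemma FF_singleton {V : Type*} (G : SimpleGraph V) (v : V) (c : ℝ) : FF G {v} c = 1 - c := by
  classical
  unfold FF
  have : (({v} : Finset V).powerset.filter
      (fun S : Finset V => S.Nonempty ∧ (G.induce (S : Set V)).Connected)) = {{v}} := by
    ext S
    simp only [Finset.mem_filter, Finset.mem_powerset, Finset.mem_singleton,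
      Finset.subset_singleton_iff]
    constructor
    · rintro ⟨rfl | rfl, h⟩
      · simp at h
      · rfl
    · rintro rfl
      exact ⟨Or.inr rfl, by simp, conn_singleton G v⟩
  rw [this]; simp

lemma FF_indep {V : Type*} (G : SimpleGraph V) (A : Finset V) (c : ℝ) :
    (∀ a ∈ A, ∀ b ∈ A, ¬ G.Adj a b) → FF G A c = A.card * (1 - c) := by
  classical
  induction A using Finset.induction_on with
  | empty => simp [FF_empty]
  | insert v A hv ih =>
    intro h
    rw [FF_disj (A := {v}) (B := A) (by simpa using hv) (by simp) _ c, FF_singleton, ih,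
      Finset.card_insert_of_notMem hv]
    · push_cast; ring
    · exact fun a ha b hb => h a (by simp [ha]) b (by simp [hb])
    · exact fun a ha b hb => h a (by simp_all) b (by simp [hb])

noncomputable def Cr (a b : ℕ) (c : ℝ) : ℝ :=
  2 ^ (a + b) * (((a : ℝ) + b) / 2 - c) - 2 ^ a * (a / 2 - c) - 2 ^ b * (b / 2 - c) - c

lemma FF_cograph {V : Type*} {G : SimpleGraph V} (hG : NoP4 G) (k : ℕ) (c : ℝ)
    (hc : ∀ a b : ℕ, 1 ≤ a → 1 ≤ b → a + b ≤ k → Cr a b c ≤ 0) (W : Finset V) :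
    W.card ≤ k → FF G W c ≤ W.card * (1 - c) := by
  classical
  induction W using Finset.strongInduction with
  | H W ih =>
    intro hk
    by_cases h2 : 2 ≤ W.card
    · obtain ⟨A, B, hA, hB, hd, hW, h⟩ := split_exists hG W h2
      have e : W = A ∪ B := by ext x; simp [hW]
      have hcard : W.card = A.card + B.card := by rw [e, Finset.card_union_of_disjoint hd]
      have hAp := hA.card_pos
      have hBp := hB.card_pos
      have hAW : A ⊂ W := by
        rw [e]; refine Finset.ssubset_iff_subset_ne.2 ⟨Finset.subset_union_left, ?_⟩
        intro h'; rw [← e] at h'; have := congrArg Finset.card h'; omega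
      have hBW : B ⊂ W := by
        rw [e]; refine Finset.ssubset_iff_subset_ne.2 ⟨Finset.subset_union_right, ?_⟩
        intro h'; rw [← e] at h'; have := congrArg Finset.card h'; omega
      have iA := ih A hAW (by omega)
      have iB := ih B hBW (by omega)
      rw [hcard]; push_cast
      rcases h with h | h
      · rw [FF_disj hd hW h]; linarith
      · rw [FF_join hd hW h]
        have := hc A.card B.card hAp hBp (by omega)
        unfold Cr at this
        linarith
    · by_cases h0 : W.card = 0
      · rw [Finset.card_eq_zero] at h0; subst h0; simp [FF_empty]
      · obtain ⟨v, rfl⟩ := Finset.card_eq_one.1 (by omega : W.card = 1)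
        rw [FF_singleton]; simp

lemma mstar_le {V : Type*} [Fintype V] {G : SimpleGraph V} (hG : NoP4 G) (c : ℝ) (h0 : 0 ≤ c)
    (hc : ∀ a b : ℕ, 1 ≤ a → 1 ≤ b → a + b ≤ Fintype.card V → Cr a b c ≤ 0) :
    mstarMean G ≤ c := by
  classical
  have h := FF_cograph hG (Fintype.card V) c hc Finset.univ le_rfl
  have e : FF G Finset.univ c = ∑ S ∈ mstarSets G, ((S.card : ℝ) - c)
      + (Finset.univ : Finset V).card * (1 - c) := by
    unfold FF
    have e1 : ((Finset.univ : Finset V).card : ℝ) * (1 - c)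
        = ∑ S ∈ (Finset.univ : Finset V).image (fun v => ({v} : Finset V)), ((S.card : ℝ) - c) := by
      rw [Finset.sum_image (by intro a _ b _ h; simpa using h)]
      simp [mul_sub]
    rw [e1, ← Finset.sum_union]
    · apply Finset.sum_congr _ (fun _ _ => rfl)
      ext S
      simp only [Finset.mem_filter, Finset.mem_powerset, Finset.subset_univ, true_and, mstarSets,
        Set.Finite.mem_toFinset, Set.mem_ofPred_eq, Finset.mem_union, Finset.mem_image,
        Finset.mem_univ]
      constructor
      · rintro ⟨h1, h2⟩
        have := h1.card_pos
        by_cases h3 : 2 ≤ S.card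
        · exact Or.inl ⟨h3, h2⟩
        · right
          obtain ⟨v, rfl⟩ := Finset.card_eq_one.1 (by omega : S.card = 1)
          exact ⟨v, rfl⟩
      · rintro (⟨h1, h2⟩ | ⟨v, rfl⟩)
        · exact ⟨Finset.card_pos.1 (by omega), h2⟩
        · exact ⟨by simp, conn_singleton G v⟩
    · rw [Finset.disjoint_left]
      intro S hS hS2
      simp only [mstarSets, Set.Finite.mem_toFinset, Set.mem_ofPred_eq, Finset.mem_image] at hS hS2
      obtain ⟨v, _, rfl⟩ := hS2
      simp at hS
  rw [e, Finset.sum_sub_distrib] at h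
  simp only [Finset.sum_const, nsmul_eq_mul] at h
  unfold mstarMean
  apply div_le_of_le_mul₀ (by positivity) h0
  linarith

lemma lt_global {V : Type*} [Fintype V] {G : SimpleGraph V} (c : ℝ)
    (h : 0 < FF G Finset.univ c) : c < globalMean G := by
  classical
  have e : FF G Finset.univ c = ∑ S ∈ connSets G, ((S.card : ℝ) - c) := by
    unfold FF
    refine Finset.sum_congr ?_ (fun _ _ => rfl)
    ext S
    simp [connSets]
  rw [e] at h
  have hp : 0 < (connSets G).card := by
    rw [Finset.card_pos, Finset.nonempty_iff_ne_empty]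
    intro h'
    rw [h'] at h; simp at h
  rw [Finset.sum_sub_distrib] at h
  simp only [Finset.sum_const, nsmul_eq_mul] at h
  unfold globalMean
  rw [lt_div_iff₀ (by exact_mod_cast hp)]
  linarith

lemma FF_bip (s t : ℕ) (c : ℝ) :
    FF (completeBipartiteGraph (Fin s) (Fin t)) Finset.univ c
      = s * (1 - c) + t * (1 - c) + Cr s t c := by
  have := FF_join (G := completeBipartiteGraph (Fin s) (Fin t)) (W := Finset.univ)
    (A := Finset.univ.map Function.Embedding.inl) (B := Finset.univ.map Function.Embedding.inr)
    (by rw [Finset.disjoint_left]; simp) (by simp) (by simp) c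
  rw [this, FF_indep, FF_indep]
  · simp [Cr]
  · simp
  · simp

lemma Cr_nonpos (a b : ℕ) (c p q : ℝ) (hp : (a : ℝ) ≤ p * (2 ^ a - 1))
    (hq : (b : ℝ) ≤ q * (2 ^ b - 1)) (h : p + q + a + b ≤ 2 * c) : Cr a b c ≤ 0 := by
  have hX : (0 : ℝ) ≤ 2 ^ a - 1 := sub_nonneg.2 (one_le_pow₀ (by norm_num))
  have hY : (0 : ℝ) ≤ 2 ^ b - 1 := sub_nonneg.2 (one_le_pow₀ (by norm_num))
  unfold Cr
  rw [pow_add]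
  generalize (2 : ℝ) ^ a = X at *
  generalize (2 : ℝ) ^ b = Y at *
  have h1 := mul_le_mul_of_nonneg_right hp hY
  have h2 := mul_le_mul_of_nonneg_right hq hX
  have h3 := mul_le_mul_of_nonneg_right h (mul_nonneg hX hY)
  nlinarith

lemma h_1 (a : ℕ) : (a : ℝ) ≤ 1 * (2 ^ a - 1) := by
  have : a + 1 ≤ 2 ^ a := Nat.lt_two_pow_self
  have : (a : ℝ) + 1 ≤ 2 ^ a := by exact_mod_cast this
  linarith

lemma h_2 (a : ℕ) (ha : 2 ≤ a) : (a : ℝ) ≤ (2 / 3) * (2 ^ a - 1) := by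
  induction a, ha using Nat.le_induction with
  | base => norm_num
  | succ a ha ih =>
    have : (2 : ℝ) ≤ a := by exact_mod_cast ha
    rw [pow_succ]; push_cast; linarith

lemma h_3 (a : ℕ) (ha : 3 ≤ a) : (a : ℝ) ≤ (3 / 7) * (2 ^ a - 1) := by
  induction a, ha using Nat.le_induction with
  | base => norm_num
  | succ a ha ih =>
    have : (3 : ℝ) ≤ a := by exact_mod_cast ha
    rw [pow_succ]; push_cast; linarith

lemma h_4 (a : ℕ) (ha : 4 ≤ a) : (a : ℝ) ≤ (4 / 15) * (2 ^ a - 1) := by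
  induction a, ha using Nat.le_induction with
  | base => norm_num
  | succ a ha ih =>
    have : (4 : ℝ) ≤ a := by exact_mod_cast ha
    rw [pow_succ]; push_cast; linarith

lemma pw3 (a : ℕ) (ha : 3 ≤ a) : (a : ℝ) ^ 2 - 1 ≤ 2 ^ a := by
  induction a, ha using Nat.le_induction with
  | base => norm_num
  | succ a ha ih =>
    have : (3 : ℝ) ≤ a := by exact_mod_cast ha
    rw [pow_succ (2 : ℝ)]; push_cast; nlinarith

lemma pw4 (a : ℕ) (ha : 4 ≤ a) : (a : ℝ) ^ 2 ≤ 2 ^ a := by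
  induction a, ha using Nat.le_induction with
  | base => norm_num
  | succ a ha ih =>
    have : (4 : ℝ) ≤ a := by exact_mod_cast ha
    rw [pow_succ (2 : ℝ)]; push_cast; nlinarith

lemma pw5 (a : ℕ) (ha : 5 ≤ a) : 10 * (a : ℝ) ^ 2 < 7 * 2 ^ a + 7 * a := by
  induction a, ha using Nat.le_induction with
  | base => norm_num
  | succ a ha ih =>
    have : (5 : ℝ) ≤ a := by exact_mod_cast ha
    rw [pow_succ (2 : ℝ)]; push_cast; nlinarith

lemma key_aux (s t : ℕ) (hs : 1 ≤ s) (hst : s ≤ t) (hn : 6 ≤ s + t) :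
    ((s : ℝ) + t) ^ 2 - (s + t) < t * 2 ^ s + s * 2 ^ t := by
  by_cases h1 : s = 1
  · subst h1
    have := pw4 t (by omega)
    have : (5 : ℝ) ≤ t := by exact_mod_cast (by omega : 5 ≤ t)
    push_cast; nlinarith
  by_cases h2 : s = 2
  · subst h2
    have := pw4 t (by omega)
    have : (4 : ℝ) ≤ t := by exact_mod_cast (by omega : 4 ≤ t)
    push_cast; nlinarith
  have a1 := pw3 s (by omega)
  have a2 := pw3 t (by omega)
  have b1 : (3 : ℝ) ≤ s := by exact_mod_cast (by omega : 3 ≤ s)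
  have b2 : (3 : ℝ) ≤ t := by exact_mod_cast (by omega : 3 ≤ t)
  have c1 := mul_le_mul_of_nonneg_left a1 (by linarith : (0 : ℝ) ≤ t)
  have c2 := mul_le_mul_of_nonneg_left a2 (by linarith : (0 : ℝ) ≤ s)
  have d : (s : ℝ) + t < s * t := by nlinarith
  have d2 := mul_lt_mul_of_pos_right d (by linarith : (0 : ℝ) < s + t)
  nlinarith

lemma key_all (s t : ℕ) (hs : 1 ≤ s) (ht : 1 ≤ t) (hn : 6 ≤ s + t) :
    ((s : ℝ) + t) ^ 2 - (s + t) < t * 2 ^ s + s * 2 ^ t := by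
  rcases le_total s t with h | h
  · exact key_aux s t hs h hn
  · have := key_aux t s ht h (by omega)
    rw [add_comm (t : ℝ) s] at this
    linarith

theorem stmt_9 {V : Type*} [Fintype V] (G : SimpleGraph V) (n s : ℕ) (hn : 6 ≤ n)
    (hs1 : 1 ≤ s) (hs2 : s ≤ n - 1) (hcog : IsCograph G) :
    (∀ k : ℕ, Fintype.card V = k → k ≤ n - 2 →
      mstarMean G < globalMean (completeBipartiteGraph (Fin s) (Fin (n - s)))) ∧
    (Fintype.card V = n - 1 →
      mstarMean G < globalMean (completeBipartiteGraph (Fin 1) (Fin (n - 1)))) := by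
  have hP := noP4_of_cograph hcog
  constructor
  · intro k hk hkn
    refine lt_of_le_of_lt (mstar_le hP ((n : ℝ) / 2) (by positivity) ?_) (lt_global _ ?_)
    · intro a b _ _ hab
      refine Cr_nonpos a b _ 1 1 (h_1 a) (h_1 b) ?_
      have : ((a + b + 2 : ℕ) : ℝ) ≤ n := by exact_mod_cast (by omega)
      push_cast at this
      linarith
    · rw [FF_bip]
      obtain ⟨t, rfl⟩ : ∃ t, n = s + t := ⟨n - s, by omega⟩
      rw [Nat.add_sub_cancel_left]
      have := key_all s t hs1 (by omega) hn
      unfold Cr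
      push_cast
      linarith
  · intro hk
    obtain ⟨m, rfl⟩ : ∃ m, n = m + 1 := ⟨n - 1, by omega⟩
    rw [Nat.add_sub_cancel] at *
    refine lt_of_le_of_lt (mstar_le hP (((m : ℝ) + 13 / 10) / 2) (by positivity) ?_)
      (lt_global _ ?_)
    · intro a b ha hb hab
      rw [hk] at hab
      by_cases hlt : a + b < m
      · refine Cr_nonpos a b _ 1 1 (h_1 a) (h_1 b) ?_
        have : ((a + b + 1 : ℕ) : ℝ) ≤ m := by exact_mod_cast (by omega)
        push_cast at this
        linarith
      have hm : (m : ℝ) = a + b := by exact_mod_cast (by omega : m = a + b)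
      by_cases ha1 : a = 1
      · exact Cr_nonpos a b _ 1 (4 / 15) (h_1 a) (h_4 b (by omega)) (by linarith)
      by_cases hb1 : b = 1
      · exact Cr_nonpos a b _ (4 / 15) 1 (h_4 a (by omega)) (h_1 b) (by linarith)
      by_cases ha2 : a = 2
      · exact Cr_nonpos a b _ (2 / 3) (3 / 7) (h_2 a (by omega)) (h_3 b (by omega)) (by linarith)
      · exact Cr_nonpos a b _ (3 / 7) (2 / 3) (h_3 a (by omega)) (h_2 b (by omega)) (by linarith)
    · rw [FF_bip]
      have := pw5 m (by omega)
      unfold Cr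
      rw [pow_add]
      push_cast
      nlinarith
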